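/- Let N ≥ 10^{100000} be a real number, M ≥ 10^5 a real number, and put δ = 1/(N·log M). Then for each integer 1 ≤ k ≤ 6, the number of integers x with M ≤ x ≤ 2M and ‖f_N(x)‖ < δ is at most C_k · (log N)^{2/(k² + k)} · M^{1 − 2/(k+1)}, where C_1 = 0.03022, C_2 = 1.04272, C_3 = 3.49005, C_4 = 6.49141, C_5 = 9.57310, C_6 = 12.5825. -/

import Mathlib

/-- Iterated Rolle theorem. -/
theorem exists_eq_zero_of_derivative_chain {a b : ℝ} (k : ℕ) (F : ℕ → ℝ → ℝ)
    (hF : ∀ j, ∀ x ∈ Set.Icc a b, HasDerivAt (F j) (F (j + 1) x) x)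
    (T : Finset ℝ) (hT : T.card = k + 1) (hab : ∀ x ∈ T, x ∈ Set.Icc a b)
    (h0 : ∀ x ∈ T, F 0 x = 0) : ∃ ξ ∈ Set.Icc a b, F k ξ = 0 := by
  induction k generalizing F T with
  | zero =>
    obtain ⟨x, hx⟩ := Finset.card_pos.mp (by omega : 0 < T.card)
    exact ⟨x, hab x hx, h0 x hx⟩
  | succ k ih =>
    set t := T.orderEmbOfFin hT
    have ht : ∀ i, t i ∈ T := fun i => T.orderEmbOfFin_mem hT i
    have hrolle : ∀ i : Fin (k + 1), ∃ ξ ∈ Set.Ioo (t i.castSucc) (t i.succ), F 1 ξ = 0 := by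
      intro i
      have hlt : t i.castSucc < t i.succ := t.strictMono (Fin.castSucc_lt_succ)
      have hsub : ∀ x ∈ Set.Icc (t i.castSucc) (t i.succ), x ∈ Set.Icc a b := fun x hx =>
        ⟨(hab _ (ht _)).1.trans hx.1, hx.2.trans (hab _ (ht _)).2⟩
      refine exists_hasDerivAt_eq_zero (f := F 0) hlt
        (fun x hx => (hF 0 x (hsub x hx)).continuousAt.continuousWithinAt) ?_
        (fun x hx => hF 0 x (hsub x (Set.Ioo_subset_Icc_self hx)))
      rw [h0 _ (ht _), h0 _ (ht _)]
    choose ξ hξ hξ0 using hrolle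
    have hmono : StrictMono ξ := by
      intro i j hij
      have hle : t i.succ ≤ t j.castSucc := t.monotone (Fin.succ_le_castSucc_iff.mpr hij)
      exact (hξ i).2.trans_le (hle.trans (hξ j).1.le)
    refine ih (fun j => F (j + 1)) (fun j => hF (j + 1)) (Finset.univ.image ξ) ?_ ?_ ?_
    · rw [Finset.card_image_of_injective _ hmono.injective, Finset.card_univ, Fintype.card_fin]
    · intro x hx
      obtain ⟨i, -, rfl⟩ := Finset.mem_image.mp hx
      exact ⟨(hab _ (ht _)).1.trans (hξ i).1.le, (hξ i).2.le.trans (hab _ (ht _)).2⟩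
    · intro x hx
      obtain ⟨i, -, rfl⟩ := Finset.mem_image.mp hx
      exact hξ0 i

/-- Mean value theorem for divided differences. -/
theorem exists_divided_difference_eq {a b : ℝ} (k : ℕ) (F : ℕ → ℝ → ℝ)
    (hF : ∀ j, ∀ x ∈ Set.Icc a b, HasDerivAt (F j) (F (j + 1) x) x)
    (T : Finset ℝ) (hT : T.card = k + 1) (hab : ∀ x ∈ T, x ∈ Set.Icc a b) :
    ∃ ξ ∈ Set.Icc a b,
      F k ξ = k.factorial * ∑ x ∈ T, F 0 x / ∏ y ∈ T.erase x, (x - y) := by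
  have hinj : Set.InjOn (id : ℝ → ℝ) T := Function.injective_id.injOn
  set P := Lagrange.interpolate T id (F 0)
  obtain ⟨ξ, hξ, h⟩ := exists_eq_zero_of_derivative_chain k
    (fun j x => F j x - (Polynomial.derivative^[j] P).eval x)
    (fun j x hx => by
      simpa only [Function.iterate_succ_apply'] using
        (hF j x hx).fun_sub ((Polynomial.derivative^[j] P).hasDerivAt x))
    T hT hab
    (fun x hx => by
      exact sub_eq_zero.mpr (Lagrange.eval_interpolate_at_node (F 0) hinj hx).symm)
  refine ⟨ξ, hξ, ?_⟩
  rw [sub_eq_zero.mp h, Lagrange.eval_iterate_derivative_eq_sum hinj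
    (Lagrange.degree_interpolate_lt _ hinj) (by omega : k < T.card), hT]
  congr 1
  refine Finset.sum_congr rfl fun x hx => ?_
  rw [Lagrange.eval_interpolate_at_node (F 0) hinj hx]
  simp

/-- The absolute value of the Vandermonde product of a finite set of integers. -/
def absVandermonde (T : Finset ℤ) : ℤ :=
  ∏ p ∈ T.offDiag with p.1 < p.2, |p.1 - p.2|

theorem absVandermonde_pos (T : Finset ℤ) : 0 < absVandermonde T := by
  refine Finset.prod_pos fun p hp => ?_
  simp only [Finset.mem_filter] at hp
  exact abs_pos.mpr (by omega)

theorem prod_sub_dvd_absVandermonde {T : Finset ℤ} {x : ℤ} (hx : x ∈ T) :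
    ∏ y ∈ T.erase x, (x - y) ∣ absVandermonde T := by
  rw [← abs_dvd, Finset.abs_prod]
  have hinj : Set.InjOn (fun y => (min x y, max x y)) (T.erase x) := by
    intro y hy z hz h
    simp only [Prod.mk.injEq] at h
    omega
  have heq : ∏ y ∈ T.erase x, |x - y|
      = ∏ p ∈ (T.erase x).image (fun y => (min x y, max x y)), |p.1 - p.2| := by
    rw [Finset.prod_image hinj]
    refine Finset.prod_congr rfl fun y _ => ?_
    simp only
    rcases le_total x y with h | h
    · simp [h]
    · simp [h, abs_sub_comm]
  rw [heq]
  refine Finset.prod_dvd_prod_of_subset _ _ _ fun p hp => ?_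
  obtain ⟨y, hy, rfl⟩ := Finset.mem_image.mp hp
  obtain ⟨hyx, hyT⟩ := Finset.mem_erase.mp hy
  rcases lt_or_gt_of_ne hyx with h | h
  · simp [h.le, hx, hyT, h, hyx]
  · simp [h.le, hx, hyT, h, hyx.symm]

theorem card_offDiag_filter_lt (T : Finset ℤ) :
    (T.offDiag.filter (fun p => p.1 < p.2)).card = T.card.choose 2 := by
  have hgt : (T.offDiag.filter (fun p => ¬ p.1 < p.2)).card
      = (T.offDiag.filter (fun p => p.1 < p.2)).card := by
    refine Finset.card_bij (fun p _ => p.swap) ?_ ?_ ?_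
    · rintro ⟨x, y⟩ h
      simp only [Finset.mem_filter, Finset.mem_offDiag, Prod.swap_prod_mk] at h ⊢
      exact ⟨⟨h.1.2.1, h.1.1, h.1.2.2.symm⟩, by omega⟩
    · rintro p _ q _ h
      exact Prod.swap_injective h
    · rintro ⟨x, y⟩ h
      simp only [Finset.mem_filter, Finset.mem_offDiag] at h
      refine ⟨(y, x), ?_, rfl⟩
      simp only [Finset.mem_filter, Finset.mem_offDiag]
      exact ⟨⟨h.1.2.1, h.1.1, h.1.2.2.symm⟩, by omega⟩
  have hsum := Finset.card_filter_add_card_filter_not (s := T.offDiag) (fun p => p.1 < p.2)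
  rw [hgt, Finset.offDiag_card, ← Nat.mul_sub_one] at hsum
  rw [Nat.choose_two_right]
  omega

theorem absVandermonde_le_pow {T : Finset ℤ} {D : ℝ}
    (hD : ∀ x ∈ T, ∀ y ∈ T, |(x : ℝ) - y| ≤ D) :
    (absVandermonde T : ℝ) ≤ D ^ T.card.choose 2 := by
  rw [← card_offDiag_filter_lt, ← Finset.prod_const, absVandermonde]
  push_cast
  refine Finset.prod_le_prod (fun _ _ => abs_nonneg _) fun p hp => ?_
  simp only [Finset.mem_filter, Finset.mem_offDiag] at hp
  exact hD _ hp.1.1 _ hp.1.2.1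

/-- If `F` is within `δ` of an integer at `k + 1` integer points and its `k`-th derivative is
bounded below and above, then these points cannot be too close to each other. -/
theorem half_le_pow_mul_of_near_integers {a b D δ l U : ℝ} (k : ℕ) (F : ℕ → ℝ → ℝ)
    (hF : ∀ j, ∀ x ∈ Set.Icc a b, HasDerivAt (F j) (F (j + 1) x) x)
    (hl : ∀ x ∈ Set.Icc a b, k.factorial * l ≤ |F k x|)
    (hU : ∀ x ∈ Set.Icc a b, |F k x| ≤ k.factorial * U)
    (T : Finset ℤ) (hT : T.card = k + 1) (hab : ∀ x ∈ T, (x : ℝ) ∈ Set.Icc a b)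
    (n : ℤ → ℤ) (hn : ∀ x ∈ T, |F 0 x - n x| ≤ δ)
    (hD : ∀ x ∈ T, ∀ y ∈ T, |(x : ℝ) - y| ≤ D)
    (hδl : (k + 1) * δ < l) (hδD : (k + 1) * δ * D ^ (k + 1).choose 2 ≤ 1 / 2) :
    1 / 2 ≤ D ^ (k + 1).choose 2 * U := by
  have hW1 : (1 : ℝ) ≤ absVandermonde T := by exact_mod_cast absVandermonde_pos T
  have hWD : (absVandermonde T : ℝ) ≤ D ^ (k + 1).choose 2 := by
    simpa only [hT] using absVandermonde_le_pow hD
  obtain ⟨ξ, hξ, hmean⟩ := exists_divided_difference_eq k F hF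
    (T.map ⟨((↑) : ℤ → ℝ), Int.cast_injective⟩) (by simpa using hT)
    (fun x hx => by
      obtain ⟨z, hz, rfl⟩ := Finset.mem_map.mp hx
      exact hab z hz)
  have hfac : (0 : ℝ) < k.factorial := by exact_mod_cast k.factorial_pos
  set W : ℝ := (absVandermonde T : ℝ)
  set w : ℤ → ℤ := fun x => absVandermonde T / ∏ y ∈ T.erase x, (x - y) with hw
  have hprod : ∀ x ∈ T, (∏ y ∈ T.erase x, (x - y) : ℤ) ≠ 0 := fun x _ =>
    Finset.prod_ne_zero_iff.mpr fun y hy => by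
      have := (Finset.mem_erase.mp hy).1
      omega
  have hwcast : ∀ x ∈ T, (w x : ℝ) = W / ∏ y ∈ T.erase x, ((x : ℝ) - y) := fun x hx => by
    rw [hw, Int.cast_div (prod_sub_dvd_absVandermonde hx) (by exact_mod_cast hprod x hx)]
    push_cast
    rfl
  have hwle : ∀ x ∈ T, |(w x : ℝ)| ≤ W := fun x hx => by
    rw [hwcast x hx, abs_div, abs_of_pos (by linarith : 0 < W)]
    refine div_le_self (by linarith) ?_
    have := Int.one_le_abs (hprod x hx)
    have h2 : (1 : ℝ) ≤ ((|∏ y ∈ T.erase x, (x - y)| : ℤ) : ℝ) := by exact_mod_cast this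
    push_cast at h2
    exact h2
  have hS : W * (F k ξ / k.factorial) = ∑ x ∈ T, F 0 x * w x := by
    rw [hmean, mul_div_cancel_left₀ _ hfac.ne', Finset.sum_map, Finset.mul_sum]
    refine Finset.sum_congr rfl fun x hx => ?_
    rw [hwcast x hx, ← Finset.map_erase, Finset.prod_map]
    simp only [Function.Embedding.coeFn_mk]
    ring
  have herr : |∑ x ∈ T, F 0 x * w x - ((∑ x ∈ T, n x * w x : ℤ) : ℝ)| ≤ (k + 1) * δ * W := by
    push_cast
    rw [← Finset.sum_sub_distrib]
    refine (Finset.abs_sum_le_sum_abs _ _).trans ?_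
    have : ∀ x ∈ T, |F 0 x * w x - n x * w x| ≤ δ * W := fun x hx => by
      rw [← sub_mul, abs_mul]
      exact mul_le_mul (hn x hx) (hwle x hx) (abs_nonneg _) ((abs_nonneg _).trans (hn x hx))
    refine (Finset.sum_le_card_nsmul _ _ _ this).trans ?_
    rw [hT, nsmul_eq_mul]
    push_cast
    linarith
  have hδ0 : 0 ≤ δ := by
    obtain ⟨x, hx⟩ := Finset.card_pos.mp (by omega : 0 < T.card)
    exact (abs_nonneg _).trans (hn x hx)
  have habs : |W * (F k ξ / k.factorial)| = W * (|F k ξ| / k.factorial) := by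
    rw [abs_mul, abs_div, abs_of_pos hfac, abs_of_pos (by linarith : 0 < W)]
  have hlow : l ≤ |F k ξ| / k.factorial := by
    rw [le_div_iff₀ hfac, mul_comm]; exact hl ξ hξ
  have hupp : |F k ξ| / k.factorial ≤ U := by
    rw [div_le_iff₀ hfac, mul_comm]; exact hU ξ hξ
  rw [← hS] at herr
  have hZ : (∑ x ∈ T, n x * w x : ℤ) ≠ 0 := by
    intro h0
    rw [h0, Int.cast_zero, sub_zero, habs] at herr
    nlinarith
  have hZ1 : (1 : ℝ) ≤ |((∑ x ∈ T, n x * w x : ℤ) : ℝ)| := by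
    exact_mod_cast Int.one_le_abs hZ
  have h1 : (k + 1) * δ * W ≤ 1 / 2 :=
    (mul_le_mul_of_nonneg_left hWD (by positivity)).trans hδD
  have h2 : 1 / 2 ≤ W * (|F k ξ| / k.factorial) := by
    rw [← habs]
    have := abs_sub_abs_le_abs_sub ((∑ x ∈ T, n x * w x : ℤ) : ℝ) (W * (F k ξ / k.factorial))
    rw [abs_sub_comm] at this
    linarith
  have h0 : 0 ≤ |F k ξ| / k.factorial := by positivity
  calc (1 : ℝ) / 2 ≤ W * (|F k ξ| / k.factorial) := h2
    _ ≤ D ^ (k + 1).choose 2 * U := mul_le_mul hWD hupp h0 (by linarith)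

/-- A finite set of integers in `[a, a + R]` without `k + 1` elements of diameter at most `D` has
at most `k (R / D + 1)` elements. -/
theorem card_le_of_no_close_subset {a R D : ℝ} (hR : 0 ≤ R) (hD : 0 < D) (k : ℕ) (S : Finset ℤ)
    (hS : ∀ x ∈ S, (x : ℝ) ∈ Set.Icc a (a + R))
    (hclose : ∀ T ⊆ S, T.card = k + 1 → ¬ ∀ x ∈ T, ∀ y ∈ T, |(x : ℝ) - y| ≤ D) :
    (S.card : ℝ) ≤ k * (R / D + 1) := by
  have hmaps : ∀ x ∈ S, ⌊((x : ℝ) - a) / D⌋₊ ∈ Finset.range (⌊R / D⌋₊ + 1) := fun x hx => by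
    rw [Finset.mem_range, Nat.lt_succ_iff]
    have := (hS x hx).2
    exact Nat.floor_le_floor (by gcongr; linarith)
  have hfib : ∀ b ∈ Finset.range (⌊R / D⌋₊ + 1),
      (S.filter (fun x : ℤ => ⌊((x : ℝ) - a) / D⌋₊ = b)).card ≤ k := by
    intro b _
    by_contra! hlt
    obtain ⟨T, hTS, hT⟩ := Finset.exists_subset_card_eq (Nat.succ_le_of_lt hlt)
    refine hclose T (hTS.trans (Finset.filter_subset _ _)) hT fun x hx y hy => ?_
    have hfl : ∀ z ∈ T, b * D ≤ (z : ℝ) - a ∧ (z : ℝ) - a < (b + 1) * D := fun z hz => by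
      obtain ⟨hzS, hzb⟩ := Finset.mem_filter.mp (hTS hz)
      have h0 : 0 ≤ ((z : ℝ) - a) / D := div_nonneg (by linarith [(hS z hzS).1]) hD.le
      obtain ⟨h1, h2⟩ := (Nat.floor_eq_iff h0).mp hzb
      exact ⟨(le_div_iff₀ hD).mp h1, (div_lt_iff₀ hD).mp h2⟩
    have hx' := hfl x hx
    have hy' := hfl y hy
    rw [abs_le]
    constructor <;> linarith
  have hcard := Finset.card_le_mul_card_image_of_maps_to hmaps k hfib
  rw [Finset.card_range] at hcard
  have hfloor : (⌊R / D⌋₊ : ℝ) ≤ R / D := Nat.floor_le (by positivity)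
  calc (S.card : ℝ) ≤ k * (⌊R / D⌋₊ + 1) := by exact_mod_cast hcard
    _ ≤ k * (R / D + 1) := by gcongr

open Polynomial in
/-- The polynomials `p` with `(1 / log) ^ (k) (x) = (-1) ^ k * p (1 / log x) / x ^ k`. -/
noncomputable def invLogPoly : ℕ → ℝ[X]
  | 0 => X
  | k + 1 => C (k : ℝ) * invLogPoly k + X ^ 2 * derivative (invLogPoly k)

theorem iteratedDeriv_inv_log (k : ℕ) {x : ℝ} (hx : 1 < x) :
    iteratedDeriv k (fun y => (Real.log y)⁻¹) x
      = (-1) ^ k * (invLogPoly k).eval (Real.log x)⁻¹ / x ^ k := by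
  induction k generalizing x with
  | zero => simp [invLogPoly]
  | succ k ih =>
    have hx0 : x ≠ 0 := by linarith
    have hlog : Real.log x ≠ 0 := (Real.log_pos hx).ne'
    have hev : iteratedDeriv k (fun y => (Real.log y)⁻¹) =ᶠ[nhds x]
        fun y => (-1) ^ k * (invLogPoly k).eval (Real.log y)⁻¹ / y ^ k := by
      filter_upwards [Ioi_mem_nhds hx] with y hy using ih hy
    rw [iteratedDeriv_succ, hev.deriv_eq]
    have h1 : HasDerivAt (fun y => (invLogPoly k).eval (Real.log y)⁻¹) _ x :=
      ((invLogPoly k).hasDerivAt _).comp x ((Real.hasDerivAt_log hx0).fun_inv hlog)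
    have h2 := (h1.const_mul ((-1) ^ k)).fun_div (hasDerivAt_pow k x) (pow_ne_zero k hx0)
    rw [h2.deriv]
    simp only [invLogPoly, Polynomial.eval_add, Polynomial.eval_mul, Polynomial.eval_C,
      Polynomial.eval_pow, Polynomial.eval_X]
    rcases k with _ | k
    · simp; field_simp
    · simp only [Nat.add_sub_cancel]
      field_simp
      ring

theorem iteratedDeriv_add_log_sub_one (L : ℝ) (k : ℕ) {x : ℝ} (hx : 1 < x) :
    iteratedDeriv (k + 1) (fun y => L + Real.log (y - 1)) x
      = (-1) ^ k * k.factorial / (x - 1) ^ (k + 1) := by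
  induction k generalizing x with
  | zero =>
    have h := ((Real.hasDerivAt_log (by linarith : x - 1 ≠ 0)).comp x
      ((hasDerivAt_id x).sub_const 1)).const_add L
    simpa [iteratedDeriv_succ] using h.deriv
  | succ k ih =>
    have hx0 : x - 1 ≠ 0 := by linarith
    have hev : iteratedDeriv (k + 1) (fun y => L + Real.log (y - 1)) =ᶠ[nhds x]
        fun y => (-1) ^ k * k.factorial / (y - 1) ^ (k + 1) := by
      filter_upwards [Ioi_mem_nhds hx] with y hy using ih hy
    rw [iteratedDeriv_succ, hev.deriv_eq]
    have h := (hasDerivAt_const x ((-1 : ℝ) ^ k * k.factorial)).fun_div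
      (((hasDerivAt_id x).sub_const 1).fun_pow (k + 1)) (pow_ne_zero _ hx0)
    simp only [id] at h
    rw [h.deriv, Nat.factorial_succ]
    push_cast
    field_simp
    simp
    ring

theorem analyticAt_add_log_sub_one (L : ℝ) {x : ℝ} (hx : 1 < x) :
    AnalyticAt ℝ (fun y => L + Real.log (y - 1)) x :=
  analyticAt_const.add ((analyticAt_id.sub analyticAt_const).log (by simpa using hx))

theorem analyticAt_inv_log {x : ℝ} (hx : 1 < x) :
    AnalyticAt ℝ (fun y => (Real.log y)⁻¹) x :=
  (analyticAt_id.log (by simp; linarith)).inv (Real.log_pos hx).ne'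

/-- The function `(L + log (x - 1)) / log x`. -/
noncomputable def logRatio (L x : ℝ) : ℝ := (L + Real.log (x - 1)) / Real.log x

theorem analyticAt_logRatio (L : ℝ) {x : ℝ} (hx : 1 < x) : AnalyticAt ℝ (logRatio L) x :=
  ((analyticAt_add_log_sub_one L hx).mul (analyticAt_inv_log hx)).congr
    (Filter.Eventually.of_forall fun _ => (div_eq_mul_inv _ _).symm)

theorem hasDerivAt_iteratedDeriv_logRatio (L : ℝ) (k : ℕ) {x : ℝ} (hx : 1 < x) :
    HasDerivAt (iteratedDeriv k (logRatio L)) (iteratedDeriv (k + 1) (logRatio L) x) x := by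
  rw [iteratedDeriv_succ, hasDerivAt_deriv_iff, iteratedDeriv_eq_iterate]
  exact ((analyticAt_logRatio L hx).iterated_deriv k).differentiableAt

theorem iteratedDeriv_logRatio (L : ℝ) (k : ℕ) {x : ℝ} (hx : 1 < x) :
    iteratedDeriv k (logRatio L) x = (-1) ^ k / x ^ k *
      ((L + Real.log (x - 1)) * (invLogPoly k).eval (Real.log x)⁻¹
        - ∑ i ∈ Finset.range k, k.choose (i + 1) * i.factorial * (x / (x - 1)) ^ (i + 1)
            * (invLogPoly (k - (i + 1))).eval (Real.log x)⁻¹) := by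
  have hx0 : x ≠ 0 := by linarith
  have hx1 : x - 1 ≠ 0 := by linarith
  have hfun : logRatio L = fun y => (L + Real.log (y - 1)) * (Real.log y)⁻¹ :=
    funext fun _ => div_eq_mul_inv _ _
  rw [hfun, iteratedDeriv_fun_mul (analyticAt_add_log_sub_one L hx).contDiffAt
    (analyticAt_inv_log hx).contDiffAt, Finset.sum_range_succ', mul_sub, Finset.mul_sum,
    sub_eq_neg_add, ← Finset.sum_neg_distrib]
  congr 1
  · refine Finset.sum_congr rfl fun i hi => ?_
    obtain ⟨j, rfl⟩ := Nat.exists_eq_add_of_lt (Finset.mem_range.mp hi)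
    rw [iteratedDeriv_add_log_sub_one L i hx, iteratedDeriv_inv_log _ hx,
      show i + j + 1 - (i + 1) = j by omega, div_pow]
    field_simp
    ring
  · rw [iteratedDeriv_zero, iteratedDeriv_inv_log _ hx]
    simp
    ring

theorem invLogPoly_eval_bounds {k : ℕ} (hk : k ≤ 6) {t : ℝ} (ht0 : 0 < t) (ht : t ≤ 1 / 11) :
    0 ≤ (invLogPoly k).eval t ∧ (invLogPoly k).eval t ≤ k.factorial * t ∧
      (1 ≤ k → (k - 1).factorial * t ^ 2 ≤ (invLogPoly k).eval t ∧
        (invLogPoly k).eval t ≤ k.factorial / 100) := by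
  have h2 : t ^ 2 ≤ t * (1 / 11) := by nlinarith
  have h3 : t ^ 3 ≤ t ^ 2 * (1 / 11) := by nlinarith [pow_pos ht0 2]
  have h4 : t ^ 4 ≤ t ^ 3 * (1 / 11) := by nlinarith [pow_pos ht0 3]
  have h5 : t ^ 5 ≤ t ^ 4 * (1 / 11) := by nlinarith [pow_pos ht0 4]
  have h6 : t ^ 6 ≤ t ^ 5 * (1 / 11) := by nlinarith [pow_pos ht0 5]
  have h7 : t ^ 7 ≤ t ^ 6 * (1 / 11) := by nlinarith [pow_pos ht0 6]
  have p2 := pow_pos ht0 2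
  have p3 := pow_pos ht0 3
  have p4 := pow_pos ht0 4
  have p5 := pow_pos ht0 5
  have p6 := pow_pos ht0 6
  have p7 := pow_pos ht0 7
  interval_cases k <;>
    simp [invLogPoly, Nat.factorial] <;> ring_nf <;>
    (repeat' apply And.intro) <;> linarith

theorem iteratedDeriv_logRatio_bounds {k : ℕ} (hk1 : 1 ≤ k) (hk : k ≤ 6) {L x : ℝ}
    (hx : (10 : ℝ) ^ 5 ≤ x) (hlog : 11 ≤ Real.log x) (hL : 100 * Real.log x ≤ L) :
    k.factorial * (1 / x ^ (k + 1)) ≤ |iteratedDeriv k (logRatio L) x| ∧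
      |iteratedDeriv k (logRatio L) x| ≤ k.factorial * (0.0101 * L / x ^ k) := by
  have hx1 : 1 < x := by norm_num at hx; linarith
  have hx0 : 0 < x := by linarith
  set t := (Real.log x)⁻¹ with ht
  have ht0 : 0 < t := by positivity
  have ht11 : t ≤ 1 / 11 := by rw [ht, inv_le_comm₀] <;> linarith
  have htx : 1 / x ≤ t := by
    rw [ht, one_div]
    exact inv_anti₀ (by linarith) ((Real.log_le_sub_one_of_pos hx0).trans (by linarith))
  set A := L + Real.log (x - 1)
  have hlog1 : 0 ≤ Real.log (x - 1) := Real.log_nonneg (by norm_num at hx; linarith)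
  have hlog2 : Real.log (x - 1) ≤ Real.log x := Real.log_le_log (by linarith) (by linarith)
  have hAL : A ≤ 1.01 * L := by simp only [A]; linarith
  have hAt : 100 ≤ A * t := by
    rw [ht, ← div_eq_mul_inv, le_div_iff₀ (by linarith)]
    simp only [A]; linarith
  have hL0 : 0 < L := by linarith
  have hA0 : 0 < A := by simp only [A]; linarith
  set E := ∑ i ∈ Finset.range k, k.choose (i + 1) * i.factorial * (x / (x - 1)) ^ (i + 1)
            * (invLogPoly (k - (i + 1))).eval t
  have hq1 : 1 ≤ x / (x - 1) := by rw [le_div_iff₀] <;> linarith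
  have hq2 : ∀ i < k, (x / (x - 1)) ^ (i + 1) ≤ 2 := fun i hi => by
    have : x / (x - 1) ≤ 1.1 := by
      rw [div_le_iff₀ (by linarith)]; norm_num at hx; linarith
    calc (x / (x - 1)) ^ (i + 1) ≤ (x / (x - 1)) ^ 6 := pow_le_pow_right₀ hq1 (by omega)
      _ ≤ 1.1 ^ 6 := by gcongr
      _ ≤ 2 := by norm_num
  have hE0 : 0 ≤ E := Finset.sum_nonneg fun i _ => by
    have := (invLogPoly_eval_bounds (by omega : k - (i + 1) ≤ 6) ht0 ht11).1
    positivity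
  have hE1 : E ≤ 30 * (k - 1).factorial * t := by
    calc E ≤ ∑ i ∈ Finset.range k, (k.choose (i + 1) * i.factorial * 2
            * ((k - (i + 1)).factorial * t) : ℝ) := by
          refine Finset.sum_le_sum fun i hi => ?_
          obtain ⟨h0, h1, -⟩ := invLogPoly_eval_bounds (by omega : k - (i + 1) ≤ 6) ht0 ht11
          have := hq2 i (Finset.mem_range.mp hi)
          gcongr
      _ ≤ 30 * (k - 1).factorial * t := by
          interval_cases k <;> simp [Finset.sum_range_succ, Nat.choose, Nat.factorial] <;>
            linarith
  obtain ⟨hp0, -, hp⟩ := invLogPoly_eval_bounds hk ht0 ht11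
  obtain ⟨hp1, hp2⟩ := hp hk1
  set p := (invLogPoly k).eval t
  have hlow : 100 * ((k - 1).factorial * t) ≤ A * p := by
    calc 100 * ((k - 1).factorial * t) ≤ (A * t) * ((k - 1).factorial * t) := by gcongr
      _ = A * ((k - 1).factorial * t ^ 2) := by ring
      _ ≤ A * p := by gcongr
  have hft : 0 < (k - 1).factorial * t := by positivity
  have hfac : (k.factorial : ℝ) ≤ 6 * (k - 1).factorial := by
    have := Nat.mul_factorial_pred (by omega : k ≠ 0)
    rw [← this]
    push_cast
    gcongr
    exact_mod_cast hk
  have habs : |iteratedDeriv k (logRatio L) x| = (A * p - E) / x ^ k := by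
    rw [iteratedDeriv_logRatio L k hx1, abs_mul, abs_div, abs_pow, abs_neg, abs_one, one_pow,
      abs_of_pos (pow_pos hx0 k), abs_of_nonneg (by linarith)]
    ring
  rw [habs]
  constructor
  · rw [le_div_iff₀ (pow_pos hx0 k), pow_succ]
    calc k.factorial * (1 / (x ^ k * x)) * x ^ k = k.factorial * (1 / x) := by field_simp
      _ ≤ 6 * (k - 1).factorial * t := by gcongr
      _ ≤ A * p - E := by linarith
  · rw [div_le_iff₀ (pow_pos hx0 k)]
    calc A * p - E ≤ A * p := by linarith
      _ ≤ 1.01 * L * (k.factorial / 100) := by gcongr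
      _ = k.factorial * (0.0101 * L / x ^ k) * x ^ k := by field_simp; norm_num

theorem eleven_le_log {x : ℝ} (hx : (10 : ℝ) ^ 5 ≤ x) : 11 ≤ Real.log x := by
  rw [Real.le_log_iff_exp_le (by norm_num at hx; linarith)]
  have h : Real.exp 11 = Real.exp 1 ^ 11 := by rw [← Real.exp_nat_mul]; norm_num
  calc Real.exp 11 = Real.exp 1 ^ 11 := h
    _ ≤ 2.7182818286 ^ 11 := by
      have := Real.exp_one_lt_d9.le
      gcongr
    _ ≤ 10 ^ 5 := by norm_num
    _ ≤ x := hx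

theorem log_le_of_mem_dyadic {M x : ℝ} (hM : (10 : ℝ) ^ 5 ≤ M) (hx : x ∈ Set.Icc M (2 * M)) :
    Real.log x ≤ 1.1 * Real.log M := by
  have hM0 : 0 < M := by norm_num at hM; linarith
  have h11 := eleven_le_log hM
  calc Real.log x ≤ Real.log (2 * M) := Real.log_le_log (by linarith [hx.1]) hx.2
    _ = Real.log 2 + Real.log M := Real.log_mul (by norm_num) hM0.ne'
    _ ≤ 1.1 * Real.log M := by linarith [Real.log_two_lt_d9]

theorem two_mul_log_sub_ge {x y : ℝ} (hx : 1000 ≤ x) (hxy : x ≤ y) :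
    0.99 * (y - x) / y ≤
      2 * (Real.log y - Real.log x) - (Real.log (y - 1) - Real.log (x - 1)) := by
  have hx0 : 0 < x := by linarith
  have hy0 : 0 < y := by linarith
  have hx1 : 0 < x - 1 := by linarith
  have hy1 : 0 < y - 1 := by linarith
  set r := y ^ 2 * (x - 1) / (x ^ 2 * (y - 1)) with hr
  have hr0 : 0 < r := by positivity
  have hlog : Real.log r
      = 2 * (Real.log y - Real.log x) - (Real.log (y - 1) - Real.log (x - 1)) := by
    rw [hr, Real.log_div (by positivity) (by positivity), Real.log_mul (by positivity) hx1.ne',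
      Real.log_mul (by positivity) hy1.ne', Real.log_pow, Real.log_pow]
    push_cast
    ring
  rw [← hlog]
  refine le_trans ?_ (Real.one_sub_inv_le_log_of_pos hr0)
  have hrinv : 1 - r⁻¹ = (y - x) * (y * (x - 1) - x) / (y ^ 2 * (x - 1)) := by
    rw [hr]
    field_simp
    ring
  rw [hrinv, div_le_div_iff₀ hy0 (by positivity)]
  have h1 : 0.99 * (y * (x - 1)) ≤ y * (x - 1) - x := by nlinarith
  calc 0.99 * (y - x) * (y ^ 2 * (x - 1)) = (y - x) * (0.99 * (y * (x - 1))) * y := by ring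
    _ ≤ (y - x) * (y * (x - 1) - x) * y := by
      have : 0 ≤ y - x := by linarith
      gcongr

theorem abs_log_sub_lt {L x δ c : ℝ} {n : ℤ} (hx : 0 < Real.log x) (hc : δ * Real.log x ≤ c)
    (h : |logRatio L x - n| < δ) :
    |L + Real.log (x - 1) - n * Real.log x| < c := by
  have : L + Real.log (x - 1) - n * Real.log x = (logRatio L x - n) * Real.log x := by
    rw [logRatio]; field_simp
  rw [this, abs_mul, abs_of_pos hx]
  exact (mul_lt_mul_of_pos_right h hx).trans_le hc

theorem sub_lt_ten_of_near_same_integer {N x y : ℝ} (hN : 10 ≤ N) (hx : 1000 ≤ x) (hxy : x ≤ y)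
    {n : ℤ} (hn : 2 ≤ n)
    (hx' : |Real.log N + Real.log (x - 1) - n * Real.log x| < 2 / N)
    (hy' : |Real.log N + Real.log (y - 1) - n * Real.log y| < 2 / N) : y - x < 10 := by
  have hn' : (2 : ℝ) ≤ n := by exact_mod_cast hn
  have hy0 : 0 < y := by linarith
  have hN0 : 0 < N := by linarith
  have hx2 := (abs_lt.mp hx').2
  have hy1 := (abs_lt.mp hy').1
  have hlogxy : Real.log x ≤ Real.log y := Real.log_le_log (by linarith) hxy
  have hlogy0 : 0 ≤ Real.log y := Real.log_nonneg (by linarith)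
  have hlogy1 : Real.log (y - 1) ≤ Real.log y := Real.log_le_log (by linarith) (by linarith)
  have h2N : 2 / N ≤ 0.2 := by rw [div_le_iff₀ hN0]; linarith
  have hyN : y ≤ 2 * N := by
    rw [← Real.log_le_log_iff hy0 (by linarith), Real.log_mul (by norm_num) hN0.ne']
    nlinarith [Real.log_two_gt_d9]
  have hmain := two_mul_log_sub_ge hx hxy
  have h4 : 0.99 * (y - x) / y < 4 / N := by
    have : 4 / N = 2 / N + 2 / N := by ring
    nlinarith
  rw [div_lt_div_iff₀ hy0 hN0] at h4
  nlinarith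

theorem card_near_integers_le_of_large {N M δ : ℝ} (hN : (10 : ℝ) ^ 5 ≤ N)
    (hM : (10 : ℝ) ^ 5 ≤ M) (hL : Real.log N ≤ 110 * Real.log M)
    (hδ : δ = 1 / (N * Real.log M)) (S : Finset ℤ)
    (hS : ∀ x ∈ S, (x : ℝ) ∈ Set.Icc M (2 * M))
    (hnear : ∀ x ∈ S, |logRatio (Real.log N) x - round (logRatio (Real.log N) x)| < δ) :
    S.card ≤ 1110 := by
  have hMlog := eleven_le_log hM
  have hNlog := eleven_le_log hN
  norm_num at hN hM
  have hlogx : ∀ x ∈ S, 11 ≤ Real.log x := fun x hx => eleven_le_log (by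
    norm_num; linarith [(hS x hx).1])
  have hδx : ∀ x ∈ S, δ * Real.log x ≤ 2 / N := fun x hx => by
    have := log_le_of_mem_dyadic (by norm_num; linarith) (hS x hx)
    rw [hδ, div_mul_eq_mul_div, div_le_div_iff₀ (by nlinarith) (by linarith)]
    nlinarith
  have hlin : ∀ x ∈ S, |Real.log N + Real.log ((x : ℝ) - 1)
      - round (logRatio (Real.log N) x) * Real.log x| < 2 / N := fun x hx =>
    abs_log_sub_lt (by linarith [hlogx x hx]) (hδx x hx) (hnear x hx)
  have h2N : 2 / N ≤ 1 := by rw [div_le_iff₀ (by linarith)]; linarith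
  have hmaps : ∀ x ∈ S, round (logRatio (Real.log N) x) ∈ Finset.Icc (2 : ℤ) 112 := by
    intro x hx
    have hxM := (hS x hx).1
    have h := abs_lt.mp (hlin x hx)
    have hlx := hlogx x hx
    have hup : Real.log ((x : ℝ) - 1) ≤ Real.log x :=
      Real.log_le_log (by linarith) (by linarith)
    have hlo : Real.log (x : ℝ) - 1 ≤ Real.log ((x : ℝ) - 1) := by
      have h1 := Real.log_le_sub_one_of_pos (x := (x : ℝ) / (x - 1))
        (div_pos (by linarith) (by linarith))
      rw [Real.log_div (by linarith) (by linarith)] at h1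
      have h2 : (x : ℝ) / (x - 1) ≤ 2 := by rw [div_le_iff₀] <;> linarith
      linarith
    have hMx : Real.log M ≤ Real.log x := Real.log_le_log (by linarith) hxM
    rw [Finset.mem_Icc]
    constructor
    · by_contra! hlt
      have : (round (logRatio (Real.log N) x) : ℝ) ≤ 1 := by
        exact_mod_cast Int.lt_add_one_iff.mp hlt
      nlinarith
    · by_contra! hlt
      have : (113 : ℝ) ≤ round (logRatio (Real.log N) x) := by exact_mod_cast hlt
      nlinarith
  have hfib : ∀ n ∈ Finset.Icc (2 : ℤ) 112,
      (S.filter (fun x : ℤ => round (logRatio (Real.log N) x) = n)).card ≤ 10 := by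
    intro n hn
    set T := S.filter (fun x : ℤ => round (logRatio (Real.log N) x) = n)
    rcases T.eq_empty_or_nonempty with h | h
    · simp [h]
    have hsub : T ⊆ Finset.Ico (T.min' h) (T.min' h + 10) := by
      intro y hy
      have hmin := T.min'_mem h
      have hle := T.min'_le y hy
      obtain ⟨hxS, hxn⟩ := Finset.mem_filter.mp hmin
      obtain ⟨hyS, hyn⟩ := Finset.mem_filter.mp hy
      have hx' := hlin _ hxS
      have hy' := hlin _ hyS
      rw [hxn] at hx'
      rw [hyn] at hy'
      have := sub_lt_ten_of_near_same_integer (by linarith) (by linarith [(hS _ hxS).1])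
        (by exact_mod_cast hle) (Finset.mem_Icc.mp hn).1 hx' hy'
      have h10 : y - T.min' h < 10 := by exact_mod_cast this
      exact Finset.mem_Ico.mpr ⟨hle, by omega⟩
    simpa using Finset.card_le_card hsub
  simpa using Finset.card_le_mul_card_image_of_maps_to hmaps 10 hfib

theorem two_thousand_le_rpow_mul_rpow {k : ℕ} (hk1 : 1 ≤ k) (hk6 : k ≤ 6) {L M : ℝ}
    (hL : (10 : ℝ) ^ 5 ≤ L) (hM : (10 : ℝ) ^ 5 ≤ M) :
    2000 ≤ L ^ ((2 : ℝ) / ((k : ℝ) ^ 2 + k)) * M ^ (1 - (2 : ℝ) / ((k : ℝ) + 1)) := by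
  have hk : (1 : ℝ) ≤ k := by exact_mod_cast hk1
  have ha : 0 ≤ (2 : ℝ) / ((k : ℝ) ^ 2 + k) := by positivity
  have hb : 0 ≤ 1 - (2 : ℝ) / ((k : ℝ) + 1) := by
    rw [sub_nonneg, div_le_one₀] <;> linarith
  have h2000 : (2000 : ℝ) ≤ ((10 : ℝ) ^ 5) ^ ((2 : ℝ) / 3) := by
    refine le_of_pow_le_pow_left₀ (n := 3) (by norm_num) (by positivity) ?_
    rw [← Real.rpow_mul_natCast (by positivity)]
    norm_num
  calc (2000 : ℝ) ≤ ((10 : ℝ) ^ 5) ^ ((2 : ℝ) / 3) := h2000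
    _ ≤ ((10 : ℝ) ^ 5) ^ ((2 : ℝ) / ((k : ℝ) ^ 2 + k) + (1 - (2 : ℝ) / ((k : ℝ) + 1))) := by
      refine Real.rpow_le_rpow_of_exponent_le (by norm_num) ?_
      interval_cases k <;> norm_num
    _ = ((10 : ℝ) ^ 5) ^ ((2 : ℝ) / ((k : ℝ) ^ 2 + k))
          * ((10 : ℝ) ^ 5) ^ (1 - (2 : ℝ) / ((k : ℝ) + 1)) := Real.rpow_add (by positivity) _ _
    _ ≤ _ := by gcongr

theorem rpow_mul_rpow_pow_choose {k : ℕ} (hk1 : 1 ≤ k) {L M : ℝ} (hL : 0 < L) (hM : 0 < M) :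
    (L ^ ((2 : ℝ) / ((k : ℝ) ^ 2 + k)) * M ^ (1 - (2 : ℝ) / ((k : ℝ) + 1))) ^ (k + 1).choose 2
      * M ^ k = L * M ^ (k + 1).choose 2 := by
  have hk : (1 : ℝ) ≤ k := by exact_mod_cast hk1
  have hc : (((k + 1).choose 2 : ℕ) : ℝ) = ((k : ℝ) ^ 2 + k) / 2 := by
    rw [Nat.cast_choose_two]; push_cast; ring
  rw [mul_pow, ← Real.rpow_mul_natCast hL.le, ← Real.rpow_mul_natCast hM.le, mul_assoc,
    ← Real.rpow_natCast M k, ← Real.rpow_add hM, ← Real.rpow_natCast M, hc]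
  congr 1
  · rw [show (2 : ℝ) / ((k : ℝ) ^ 2 + k) * (((k : ℝ) ^ 2 + k) / 2) = 1 by field_simp,
      Real.rpow_one]
  · congr 1
    field_simp
    ring

theorem card_near_integers_le_of_small {N M δ lam : ℝ} {k : ℕ} (hk1 : 1 ≤ k) (hk6 : k ≤ 6)
    (hN : 0 < N) (hM : (10 : ℝ) ^ 5 ≤ M) (hL : 110 * Real.log M ≤ Real.log N)
    (hδ : δ = 1 / (N * Real.log M)) (hlam0 : 0 < lam) (hlam : lam ^ (k + 1).choose 2 ≤ 34)
    (S : Finset ℤ) (hS : ∀ x ∈ S, (x : ℝ) ∈ Set.Icc M (2 * M))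
    (hnear : ∀ x ∈ S, |logRatio (Real.log N) x - round (logRatio (Real.log N) x)| < δ) :
    (S.card : ℝ) ≤ k * (Real.log N ^ ((2 : ℝ) / ((k : ℝ) ^ 2 + k))
      * M ^ (1 - (2 : ℝ) / ((k : ℝ) + 1)) / lam + 1) := by
  have hMlog := eleven_le_log hM
  have hM' := hM
  norm_num at hM'
  have hM0 : 0 < M := by linarith
  have hL0 : 1 ≤ Real.log N := by linarith
  have hX := rpow_mul_rpow_pow_choose hk1 (by linarith : 0 < Real.log N) hM0
  set X := Real.log N ^ ((2 : ℝ) / ((k : ℝ) ^ 2 + k)) * M ^ (1 - (2 : ℝ) / ((k : ℝ) + 1))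
  have hX0 : 0 < X := by positivity
  have hMD : X / lam = M / (lam * M / X) := by field_simp
  rw [hMD]
  refine card_le_of_no_close_subset (a := M) hM0.le (by positivity) k S
    (fun x hx => by simpa only [two_mul] using hS x hx) fun T hTS hT hclose => ?_
  have hDpow : (lam * M / X) ^ (k + 1).choose 2
      = lam ^ (k + 1).choose 2 * (M ^ k / Real.log N) := by
    rw [div_pow, mul_pow]
    field_simp
    linear_combination -hX
  have hNM : M ^ 10 ≤ N := by
    rw [← Real.log_le_log_iff (by positivity) hN, Real.log_pow]
    push_cast
    linarith
  have hδM : δ * M ^ 10 < 1 := by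
    rw [hδ, div_mul_eq_mul_div, div_lt_one (by positivity)]
    nlinarith
  have hδ0 : 0 < δ := by rw [hδ]; positivity
  have hkR : (k : ℝ) + 1 ≤ 7 := by
    have : (k : ℝ) ≤ 6 := by exact_mod_cast hk6
    linarith
  have hM3 : 896 ≤ M ^ 3 := by nlinarith [pow_le_pow_left₀ (by norm_num) hM' 3]
  have hbounds : ∀ x ∈ Set.Icc M (2 * M), _ := fun x hx =>
    iteratedDeriv_logRatio_bounds hk1 hk6 (hM.trans hx.1) (eleven_le_log (hM.trans hx.1))
      (by linarith [log_le_of_mem_dyadic hM hx] : 100 * Real.log x ≤ Real.log N)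
  have hhalf := half_le_pow_mul_of_near_integers (a := M) (b := 2 * M) (D := lam * M / X) (δ := δ)
    (l := 1 / (2 * M) ^ (k + 1)) (U := 0.0101 * Real.log N / M ^ k)
    k (fun j => iteratedDeriv j (logRatio (Real.log N)))
    (fun j x hx => hasDerivAt_iteratedDeriv_logRatio _ j (by linarith [hx.1]))
    (fun x hx => by
      refine le_trans ?_ (hbounds x hx).1
      have := hx.1
      have := hx.2
      have : 0 < x := by linarith
      gcongr)
    (fun x hx => by
      refine (hbounds x hx).2.trans ?_
      have := hx.1
      have : 0 ≤ Real.log N := by linarith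
      gcongr)
    T hT (fun x hx => hS x (hTS hx)) (fun x => round (logRatio (Real.log N) x))
    (fun x hx => by simpa only [iteratedDeriv_zero] using (hnear x (hTS hx)).le) hclose
    (by
      rw [lt_div_iff₀ (by positivity)]
      calc ((k : ℝ) + 1) * δ * (2 * M) ^ (k + 1) ≤ 7 * δ * (2 * M) ^ 7 := by
            gcongr
            · linarith
            · omega
        _ = δ * (896 * M ^ 7) := by ring
        _ ≤ δ * (M ^ 3 * M ^ 7) := by gcongr
        _ = δ * M ^ 10 := by ring
        _ < 1 := hδM)
    (by
      rw [hDpow]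
      calc ((k : ℝ) + 1) * δ * (lam ^ (k + 1).choose 2 * (M ^ k / Real.log N))
          ≤ 7 * δ * (34 * (M ^ 6 / 1)) := by
            gcongr
            linarith
        _ = δ * (238 * M ^ 6) := by ring
        _ ≤ δ * (1 / 2 * (M * M ^ 3) * M ^ 6) := by
            gcongr
            nlinarith
        _ = 1 / 2 * (δ * M ^ 10) := by ring
        _ ≤ 1 / 2 := by linarith)
  rw [hDpow] at hhalf
  have : lam ^ (k + 1).choose 2 * (M ^ k / Real.log N) * (0.0101 * Real.log N / M ^ k)
      = lam ^ (k + 1).choose 2 * 0.0101 := by field_simp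
  linarith

open scoped Classical in
theorem stmt11 (N : ℝ) (hN : (10 : ℝ) ^ (100000 : ℕ) ≤ N)
    (M : ℝ) (hM : (10 : ℝ) ^ (5 : ℕ) ≤ M)
    (k : ℕ) (hk1 : 1 ≤ k) (hk6 : k ≤ 6) (δ : ℝ) (hδ : δ = 1 / (N * Real.log M)) :
    (((Finset.Icc ⌈M⌉ ⌊2 * M⌋).filter (fun x : ℤ =>
        |(Real.log N + Real.log ((x : ℝ) - 1)) / Real.log (x : ℝ)
          - round ((Real.log N + Real.log ((x : ℝ) - 1)) / Real.log (x : ℝ))| < δ)).card : ℝ)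
      ≤ (if k = 1 then 0.03022 else if k = 2 then 1.04272 else if k = 3 then 3.49005
          else if k = 4 then 6.49141 else if k = 5 then 9.57310 else (12.5825 : ℝ))
          * Real.log N ^ ((2 : ℝ) / ((k : ℝ) ^ 2 + k)) * M ^ (1 - (2 : ℝ) / ((k : ℝ) + 1)) := by
  have hN5 : (10 : ℝ) ^ 5 ≤ N := (pow_le_pow_right₀ (by norm_num) (by norm_num)).trans hN
  have hN0 : 0 < N := lt_of_lt_of_le (by positivity) hN5
  have hL : (10 : ℝ) ^ 5 ≤ Real.log N := by
    have h10 : 1 ≤ Real.log 10 := by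
      rw [Real.le_log_iff_exp_le (by norm_num)]
      linarith [Real.exp_one_lt_d9]
    have h := Real.log_le_log (by positivity) hN
    rw [Real.log_pow] at h
    push_cast at h
    linarith
  set S := (Finset.Icc ⌈M⌉ ⌊2 * M⌋).filter (fun x : ℤ =>
        |(Real.log N + Real.log ((x : ℝ) - 1)) / Real.log (x : ℝ)
          - round ((Real.log N + Real.log ((x : ℝ) - 1)) / Real.log (x : ℝ))| < δ)
  have hS : ∀ x ∈ S, (x : ℝ) ∈ Set.Icc M (2 * M) := fun x hx => by
    obtain ⟨h1, h2⟩ := Finset.mem_Icc.mp (Finset.mem_filter.mp hx).1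
    exact ⟨Int.ceil_le.mp h1, Int.le_floor.mp h2⟩
  have hnear : ∀ x ∈ S, |logRatio (Real.log N) x - round (logRatio (Real.log N) x)| < δ :=
    fun x hx => (Finset.mem_filter.mp hx).2
  rw [mul_assoc]
  have hX := two_thousand_le_rpow_mul_rpow hk1 hk6 hL hM
  rcases le_total (110 * Real.log M) (Real.log N) with hLM | hLM
  · have hsmall : ∀ lam : ℝ, 0 < lam → lam ^ (k + 1).choose 2 ≤ 34 → _ := fun lam h0 h =>
      card_near_integers_le_of_small hk1 hk6 hN0 hM hLM hδ h0 h S hS hnear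
    set X := Real.log N ^ ((2 : ℝ) / ((k : ℝ) ^ 2 + k)) * M ^ (1 - (2 : ℝ) / ((k : ℝ) + 1))
    clear_value X
    obtain rfl | rfl | hk3 : k = 1 ∨ k = 2 ∨ 3 ≤ k := by omega
    · have := hsmall 34 (by norm_num) (by norm_num)
      norm_num at this ⊢
      linarith
    · have := hsmall 2 (by norm_num) (by norm_num [Nat.choose])
      norm_num at this ⊢
      linarith
    · have := hsmall 1 (by norm_num) (by norm_num)
      interval_cases k <;> norm_num at this ⊢ <;> linarith
  · have hcard : (S.card : ℝ) ≤ 1110 := by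
      exact_mod_cast card_near_integers_le_of_large hN5 hM hLM hδ S hS hnear
    obtain rfl | hk2 := hk1.eq_or_lt
    · norm_num at hL ⊢
      linarith
    · set X := Real.log N ^ ((2 : ℝ) / ((k : ℝ) ^ 2 + k)) * M ^ (1 - (2 : ℝ) / ((k : ℝ) + 1))
      clear_value X
      interval_cases k <;> norm_num <;> linarith
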